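/- Under the bijection between (n+1-k)-strict partitions λ ∈ Λ^{2n+2}_k and minimal length representatives w ∈ W^{P_k} of type C_{n+1}, one has ℓ(w) = k(2n+2-k) - k(k-1)/2 - |λ|, where |λ| = λ_1 + ⋯ + λ_k. Equivalently, the codimension of the corresponding Schubert variety in IG(k, 2n+2) equals |λ|. -/

import Mathlib

def bar (n : ℕ) (i : Fin (2*n+2)) : Fin (2*n+2) := ⟨2*n+1 - i, by have := i.isLt; omega⟩

def IsSigned (n : ℕ) (w : Equiv.Perm (Fin (2*n+2))) : Prop :=
  ∀ i, w (bar n i) = bar n (w i)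

def IsOddSymp (n : ℕ) (w : Equiv.Perm (Fin (2*n+2))) : Prop :=
  ∀ j : Fin (2*n+2), (j : ℕ) < n+1 → (w j : ℕ) ≠ 2*n+1

def sgen (n : ℕ) (i : Fin (n+1)) : Equiv.Perm (Fin (2*n+2)) :=
  if h : (i : ℕ) < n then
    (Equiv.swap ⟨i, by omega⟩ ⟨(i : ℕ)+1, by omega⟩) *
      (Equiv.swap ⟨2*n - i, by omega⟩ ⟨2*n+1 - i, by omega⟩)
  else Equiv.swap ⟨n, by omega⟩ ⟨n+1, by omega⟩

noncomputable def len (n : ℕ) (w : Equiv.Perm (Fin (2*n+2))) : ℕ :=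
  sInf {m | ∃ l : List (Fin (n+1)), l.length = m ∧ (l.map (sgen n)).prod = w}

def WP (n k : ℕ) : Subgroup (Equiv.Perm (Fin (2*n+2))) :=
  Subgroup.closure {x | ∃ i : Fin (n+1), (i : ℕ) ≠ k - 1 ∧ x = sgen n i}

noncomputable def IsMinRep (n k : ℕ) (w : Equiv.Perm (Fin (2*n+2))) : Prop :=
  ∀ p ∈ WP n k, len n w ≤ len n (w * p)

noncomputable def cosetLen (n k : ℕ) (w : Equiv.Perm (Fin (2*n+2))) : ℕ :=
  sInf {m | ∃ p ∈ WP n k, len n (w * p) = m}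

def s2t1 (n : ℕ) : Equiv.Perm (Fin (2*n+2)) := Equiv.swap ⟨0, by omega⟩ ⟨2*n+1, by omega⟩

def st1t2 (n : ℕ) : Equiv.Perm (Fin (2*n+2)) :=
  Equiv.swap ⟨0, by omega⟩ ⟨2*n, by omega⟩ * Equiv.swap ⟨1, by omega⟩ ⟨2*n+1, by omega⟩

/-- The `(n+1-k)`-strict partition associated to `w ∈ W^{P_k}`:
`λ_j = 2n+3-k-w(j) + #{i<j : w(i)+w(j) > 2n+3}` (values 1-based). -/
def partOfEven (n k : ℕ) (hk : k ≤ 2*n+2) (σ : Equiv.Perm (Fin (2*n+2))) (j : Fin k) : ℤ :=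
  ((2*n+3 : ℤ) - k) - (((σ (Fin.castLE hk j) : ℕ) : ℤ) + 1) +
    (Finset.univ.filter (fun i : Fin k => i < j ∧
      ((σ (Fin.castLE hk i) : ℕ) + 1) + ((σ (Fin.castLE hk j) : ℕ) + 1) > 2*n+3)).card

/-- Weight of a pair of positions. -/
def wt7 (n : ℕ) (a b : Fin (2*n+2)) : ℤ := if (a : ℕ) + b = 2*n+1 then 2 else 1

/-- Weighted inversion number; it is twice the Coxeter length. -/
def Q7 (n : ℕ) (w : Equiv.Perm (Fin (2*n+2))) : ℤ :=
  ∑ a, ∑ b, if a < b ∧ w b < w a then wt7 n a b else 0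

theorem bar_val7 (n : ℕ) (a : Fin (2*n+2)) : (bar n a : ℕ) = 2*n+1 - a := rfl

theorem bar_bar7 (n : ℕ) (a : Fin (2*n+2)) : bar n (bar n a) = a := by
  apply Fin.ext; simp only [bar_val7]; omega

def barE7 (n : ℕ) : Equiv.Perm (Fin (2*n+2)) := ⟨bar n, bar n, bar_bar7 n, bar_bar7 n⟩

theorem sgen_val7 (n : ℕ) (i : Fin (n+1)) (a : Fin (2*n+2)) :
    (sgen n i a : ℕ) = if (a:ℕ) = i then (i:ℕ)+1 else if (a:ℕ) = i+1 then (i:ℕ) else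
      if (a:ℕ) = 2*n - i then 2*n+1-i else if (a:ℕ) = 2*n+1-i then 2*n-i else a := by
  have hi := i.isLt
  have ha := a.isLt
  unfold sgen
  split_ifs with h <;>
    simp only [Equiv.Perm.mul_apply, Equiv.swap_apply_def, Fin.ext_iff] <;>
    repeat' split_ifs
  all_goals (try simp only at *)
  all_goals omega

theorem sgen_sgen7 (n : ℕ) (i : Fin (n+1)) (a : Fin (2*n+2)) : sgen n i (sgen n i a) = a := by
  have hi := i.isLt
  have ha := a.isLt
  apply Fin.ext
  have h1 := sgen_val7 n i a
  have h2 := sgen_val7 n i (sgen n i a)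
  split_ifs at h1 <;> split_ifs at h2 <;> omega

theorem sgen_mul_self7 (n : ℕ) (i : Fin (n+1)) : sgen n i * sgen n i = 1 := by
  ext a; simp [sgen_sgen7]

theorem sgen_signed7 (n : ℕ) (i : Fin (n+1)) : IsSigned n (sgen n i) := by
  intro a
  have hi := i.isLt
  have ha := a.isLt
  apply Fin.ext
  have h1 := sgen_val7 n i a
  have h2 := sgen_val7 n i (bar n a)
  have h3 := bar_val7 n a
  have h4 := bar_val7 n (sgen n i a)
  split_ifs at h1 <;> split_ifs at h2 <;> omega

theorem mul_signed7 {n : ℕ} {u v : Equiv.Perm (Fin (2*n+2))} (hu : IsSigned n u)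
    (hv : IsSigned n v) : IsSigned n (u * v) := by
  intro a
  simp only [Equiv.Perm.mul_apply]
  rw [hv, hu]

theorem Q7_mul (n : ℕ) (w : Equiv.Perm (Fin (2*n+2))) (i : Fin (n+1)) :
    Q7 n (w * sgen n i) =
      ∑ a, ∑ b, if sgen n i a < sgen n i b ∧ w b < w a then wt7 n a b else 0 := by
  unfold Q7
  rw [← Equiv.sum_comp (sgen n i)]
  refine Finset.sum_congr rfl fun a _ => ?_
  rw [← Equiv.sum_comp (sgen n i)]
  refine Finset.sum_congr rfl fun b _ => ?_
  simp only [Equiv.Perm.mul_apply, sgen_sgen7]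
  have : wt7 n (sgen n i a) (sgen n i b) = wt7 n a b := by
    have hi := i.isLt
    have ha := a.isLt
    have hb := b.isLt
    have h1 := sgen_val7 n i a
    have h2 := sgen_val7 n i b
    have : (sgen n i a : ℕ) + sgen n i b = 2*n+1 ↔ (a : ℕ) + b = 2*n+1 := by
      split_ifs at h1 <;> split_ifs at h2 <;> omega
    simp only [wt7, this]
  rw [this]

theorem arith7 (n i a b sa sb wa wb w1 w2 w3 w4 : ℕ) (hi : i ≤ n) (ha : a < 2*n+2) (hb : b < 2*n+2)
    (h1 : sa = if a = i then i+1 else if a = i+1 then i else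
      if a = 2*n - i then 2*n+1-i else if a = 2*n+1-i then 2*n-i else a)
    (h2 : sb = if b = i then i+1 else if b = i+1 then i else
      if b = 2*n - i then 2*n+1-i else if b = 2*n+1-i then 2*n-i else b)
    (e1 : w3 = 2*n+1 - w2) (e2 : w4 = 2*n+1 - w1) (l1 : w1 < 2*n+2) (l2 : w2 < 2*n+2)
    (h : w2 < w1)
    (A1 : a = i → wa = w1) (A2 : a = i+1 → wa = w2) (A3 : a = 2*n-i → wa = w3)
    (A4 : a = 2*n+1-i → wa = w4)
    (B1 : b = i → wb = w1) (B2 : b = i+1 → wb = w2) (B3 : b = 2*n-i → wb = w3)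
    (B4 : b = 2*n+1-i → wb = w4) :
    (if a < b ∧ wb < wa then (if a + b = 2*n+1 then (2:ℤ) else 1) else 0) -
      (if sa < sb ∧ wb < wa then (if a + b = 2*n+1 then (2:ℤ) else 1) else 0) =
      (if a = i then (if b = i+1 then (1:ℤ) else 0) else 0) +
      (if a = 2*n-i then (if b = 2*n+1-i then (1:ℤ) else 0) else 0) := by
  by_cases P : (a = i ∧ b = i+1) ∨ (a = 2*n-i ∧ b = 2*n+1-i)
  · have hw : wb < wa := by omega
    have hab : a < b := by omega
    have hs : ¬ sa < sb := by
      rcases P with ⟨rfl, rfl⟩ | ⟨rfl, rfl⟩ <;> split_ifs at h1 h2 <;> omega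
    simp only [hw, hab, hs, and_true, if_true, if_false, false_and]
    split_ifs <;> omega
  by_cases P' : (b = i ∧ a = i+1) ∨ (b = 2*n-i ∧ a = 2*n+1-i)
  · have hw : ¬ wb < wa := by omega
    simp only [hw, and_false, if_false]
    split_ifs <;> omega
  have hs : sa < sb ↔ a < b := by
    clear A1 A2 A3 A4 B1 B2 B3 B4 e1 e2 h l1 l2
    split_ifs at h1 <;> split_ifs at h2 <;> omega
  simp only [hs, sub_self]
  split_ifs <;> omega

theorem Q7_desc (n : ℕ) (w : Equiv.Perm (Fin (2*n+2))) (hw : IsSigned n w) (i : Fin (n+1))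
    (h : w ⟨i+1, by omega⟩ < w ⟨i, by omega⟩) : Q7 n (w * sgen n i) + 2 = Q7 n w := by
  have hi := i.isLt
  have key : ∀ a b : Fin (2*n+2), (if a < b ∧ w b < w a then wt7 n a b else 0) -
      (if sgen n i a < sgen n i b ∧ w b < w a then wt7 n a b else 0) =
      (if a = ⟨i, by omega⟩ then (if b = ⟨i+1, by omega⟩ then (1:ℤ) else 0) else 0) +
      (if a = ⟨2*n-i, by omega⟩ then (if b = ⟨2*n+1-i, by omega⟩ then (1:ℤ) else 0) else 0) := by
    intro a b
    have ha := a.isLt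
    have hb := b.isLt
    have h1 := sgen_val7 n i a
    have h2 := sgen_val7 n i b
    have e1 : (w ⟨2*n-i, by omega⟩ : ℕ) = 2*n+1 - w ⟨i+1, by omega⟩ := by
      rw [← bar_val7, ← hw]; congr 2; apply Fin.ext; simp only [bar_val7]; omega
    have e2 : (w ⟨2*n+1-i, by omega⟩ : ℕ) = 2*n+1 - w ⟨i, by omega⟩ := by
      rw [← bar_val7, ← hw]; congr 2
    have l1 := (w ⟨i, by omega⟩).isLt
    have l2 := (w ⟨i+1, by omega⟩).isLt
    rw [Fin.lt_def] at h
    have A : ∀ m (hm : m < 2*n+2), (a : ℕ) = m → (w a : ℕ) = w ⟨m, hm⟩ := by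
      rintro m hm rfl; rfl
    have B : ∀ m (hm : m < 2*n+2), (b : ℕ) = m → (w b : ℕ) = w ⟨m, hm⟩ := by
      rintro m hm rfl; rfl
    have A1 := A i (by omega)
    have A2 := A (i+1) (by omega)
    have A3 := A (2*n-i) (by omega)
    have A4 := A (2*n+1-i) (by omega)
    have B1 := B i (by omega)
    have B2 := B (i+1) (by omega)
    have B3 := B (2*n-i) (by omega)
    have B4 := B (2*n+1-i) (by omega)
    clear A B
    simp only [wt7, Fin.lt_def, Fin.ext_iff]
    generalize (w a : ℕ) = wa at *
    generalize (w b : ℕ) = wb at *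
    generalize (w ⟨i, _⟩ : ℕ) = w1 at *
    generalize (w ⟨i+1, _⟩ : ℕ) = w2 at *
    generalize (w ⟨2*n-i, _⟩ : ℕ) = w3 at *
    generalize (w ⟨2*n+1-i, _⟩ : ℕ) = w4 at *
    generalize (sgen n i a : ℕ) = sa at *
    generalize (sgen n i b : ℕ) = sb at *
    exact arith7 n i a b sa sb wa wb w1 w2 w3 w4 (by omega) ha hb h1 h2 e1 e2 l1 l2 h
      A1 A2 A3 A4 B1 B2 B3 B4
  have := Finset.sum_congr (rfl : (Finset.univ : Finset (Fin (2*n+2))) = _) fun a _ =>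
    Finset.sum_congr (rfl : (Finset.univ : Finset (Fin (2*n+2))) = _) fun b _ => key a b
  have r : ∀ c d : Fin (2*n+2), ∑ a, ∑ b, (if a = c then (if b = d then (1:ℤ) else 0) else 0) = 1 := by
    intro c d
    rw [Finset.sum_eq_single c] <;> simp +contextual
  simp only [Finset.sum_sub_distrib, Finset.sum_add_distrib, r] at this
  rw [Q7_mul]
  unfold Q7
  linarith

theorem Q7_asc (n : ℕ) (w : Equiv.Perm (Fin (2*n+2))) (hw : IsSigned n w) (i : Fin (n+1))
    (h : w ⟨i, by omega⟩ < w ⟨i+1, by omega⟩) : Q7 n (w * sgen n i) = Q7 n w + 2 := by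
  have := Q7_desc n (w * sgen n i) (mul_signed7 hw (sgen_signed7 n i)) i (by
    have e1 : sgen n i ⟨i, by omega⟩ = ⟨i+1, by omega⟩ := by
      apply Fin.ext; rw [sgen_val7]; simp
    have e2 : sgen n i ⟨i+1, by omega⟩ = ⟨i, by omega⟩ := by
      apply Fin.ext; rw [sgen_val7]; simp
    simpa [e1, e2] using h)
  rw [mul_assoc, sgen_mul_self7, mul_one] at this
  exact this.symm

theorem Q7_nonneg (n : ℕ) (w : Equiv.Perm (Fin (2*n+2))) : 0 ≤ Q7 n w := by
  unfold Q7 wt7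
  refine Finset.sum_nonneg fun a _ => Finset.sum_nonneg fun b _ => ?_
  split_ifs <;> norm_num

theorem Q7_one (n : ℕ) : Q7 n 1 = 0 := by
  unfold Q7
  refine Finset.sum_eq_zero fun a _ => Finset.sum_eq_zero fun b _ => ?_
  rw [if_neg]
  rintro ⟨h1, h2⟩
  exact lt_asymm h1 h2

/-- adjacent ascents give monotonicity on an interval -/
theorem mono7 (n : ℕ) (w : Equiv.Perm (Fin (2*n+2))) (p q : ℕ)
    (h : ∀ c (hc : c + 1 < 2*n+2), p ≤ c → c + 1 ≤ q → w ⟨c, by omega⟩ < w ⟨c+1, hc⟩)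
    (a : ℕ) (d : ℕ) (hb : a + d + 1 < 2*n+2) (hp : p ≤ a) (hq : a + d + 1 ≤ q) :
    w ⟨a, by omega⟩ < w ⟨a+d+1, hb⟩ := by
  induction d with
  | zero => exact h a hb hp hq
  | succ d ih => exact lt_trans (ih (by omega) (by omega)) (h (a+d+1) hb (by omega) hq)

theorem mono7' (n : ℕ) (w : Equiv.Perm (Fin (2*n+2))) (p q : ℕ)
    (h : ∀ c (hc : c + 1 < 2*n+2), p ≤ c → c + 1 ≤ q → w ⟨c, by omega⟩ < w ⟨c+1, hc⟩)
    (a b : Fin (2*n+2)) (hp : p ≤ a) (hq : (b:ℕ) ≤ q) (hab : a < b) : w a < w b := by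
  obtain ⟨d, hd⟩ := Nat.exists_eq_add_of_lt (Fin.lt_def.1 hab)
  have := mono7 n w p q h a d (by omega) hp (by omega)
  convert this

/-- ascents in the lower half reflect to the upper half -/
theorem asc_refl7 (n : ℕ) (w : Equiv.Perm (Fin (2*n+2))) (hw : IsSigned n w) (c : ℕ)
    (hc : c + 1 < 2*n+2)
    (h : w ⟨2*n-c, by omega⟩ < w ⟨2*n-c+1, by omega⟩) : w ⟨c, by omega⟩ < w ⟨c+1, hc⟩ := by
  have e1 : (⟨c, by omega⟩ : Fin (2*n+2)) = bar n ⟨2*n-c+1, by omega⟩ := by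
    apply Fin.ext; simp only [bar_val7]; omega
  have e2 : (⟨c+1, hc⟩ : Fin (2*n+2)) = bar n ⟨2*n-c, by omega⟩ := by
    apply Fin.ext; simp only [bar_val7]; omega
  rw [e1, e2, hw, hw, Fin.lt_def, bar_val7, bar_val7]
  rw [Fin.lt_def] at h
  omega

theorem exists_desc7 (n : ℕ) (w : Equiv.Perm (Fin (2*n+2))) (hw : IsSigned n w) (h1 : w ≠ 1) :
    ∃ i : Fin (n+1), w ⟨i+1, by omega⟩ < w ⟨i, by omega⟩ := by
  by_contra hcon
  push Not at hcon
  apply h1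
  have hl : ∀ c (hc : c + 1 < 2*n+2), c ≤ n → w ⟨c, by omega⟩ < w ⟨c+1, hc⟩ := by
    intro c hc hcn
    refine lt_of_le_of_ne (hcon ⟨c, by omega⟩) ?_
    intro h
    have := w.injective h
    simp [Fin.ext_iff] at this
  have hm : StrictMono w := by
    intro a b hab
    refine mono7' n w 0 (2*n+2) ?_ a b (by omega) (by omega) hab
    intro c hc _ _
    by_cases hcn : c ≤ n
    · exact hl c hc hcn
    · exact asc_refl7 n w hw c hc (hl (2*n-c) (by omega) (by omega))
  have : (w : Fin (2*n+2) → Fin (2*n+2)) = id := by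
    have h3 := hm.range_inj (strictMono_id (α := Fin (2*n+2)))
    apply h3.1
    simp [w.surjective.range_eq]
  ext a
  simp [this]

theorem word7 (n : ℕ) (l : List (Fin (n+1))) :
    IsSigned n (l.map (sgen n)).prod ∧ Q7 n (l.map (sgen n)).prod ≤ 2 * l.length := by
  induction l using List.reverseRecOn with
  | nil => exact ⟨fun a => rfl, by simp [Q7_one]⟩
  | append_singleton l i ih =>
    obtain ⟨h1, h2⟩ := ih
    simp only [List.map_append, List.map_cons, List.map_nil, List.prod_append, List.prod_cons,
      List.prod_nil, mul_one, List.length_append, List.length_cons, List.length_nil]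
    refine ⟨mul_signed7 h1 (sgen_signed7 n i), ?_⟩
    rcases lt_trichotomy ((l.map (sgen n)).prod ⟨i, by omega⟩)
      ((l.map (sgen n)).prod ⟨i+1, by omega⟩) with h | h | h
    · rw [Q7_asc n _ h1 i h]; push_cast; linarith
    · have := (l.map (sgen n)).prod.injective h
      simp [Fin.ext_iff] at this
    · have := Q7_desc n _ h1 i h
      push_cast; linarith

theorem exists_word7 (n : ℕ) : ∀ m : ℕ, ∀ w : Equiv.Perm (Fin (2*n+2)), IsSigned n w →
    Q7 n w ≤ m → ∃ l : List (Fin (n+1)), (l.map (sgen n)).prod = w ∧ 2 * (l.length : ℤ) = Q7 n w := by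
  intro m
  induction m using Nat.strong_induction_on with
  | _ m ih =>
    intro w hw hm
    by_cases h1 : w = 1
    · exact ⟨[], by simp [h1], by simp [h1, Q7_one]⟩
    · obtain ⟨i, hi⟩ := exists_desc7 n w hw h1
      have hd := Q7_desc n w hw i hi
      have h0 := Q7_nonneg n (w * sgen n i)
      obtain ⟨l, hl1, hl2⟩ := ih (m-1) (by omega) (w * sgen n i)
        (mul_signed7 hw (sgen_signed7 n i)) (by omega)
      refine ⟨l ++ [i], ?_, ?_⟩
      · simp [hl1, mul_assoc, sgen_mul_self7]
      · simp only [List.length_append, List.length_cons, List.length_nil]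
        push_cast; linarith

theorem len7 (n : ℕ) (w : Equiv.Perm (Fin (2*n+2))) (hw : IsSigned n w) :
    2 * (len n w : ℤ) = Q7 n w := by
  obtain ⟨l, hl1, hl2⟩ := exists_word7 n (Q7 n w).toNat w hw (by omega)
  have hle : len n w ≤ l.length := Nat.sInf_le ⟨l, rfl, hl1⟩
  have hmem : len n w ∈ {m | ∃ l : List (Fin (n+1)), l.length = m ∧ (l.map (sgen n)).prod = w} :=
    Nat.sInf_mem ⟨_, l, rfl, hl1⟩
  obtain ⟨l', h1, h2⟩ := hmem
  have := (word7 n l').2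
  rw [h2, h1] at this
  omega

theorem asc7 (n k : ℕ) (hk : 1 ≤ k)
    (σ : Equiv.Perm (Fin (2*n+2))) (hσ : IsSigned n σ) (hmin : IsMinRep n k σ)
    (c : ℕ) (hc : c + 1 < 2*n+2) (h1 : c + 1 ≠ k) (h2 : c + k ≠ 2*n+1) :
    σ ⟨c, by omega⟩ < σ ⟨c+1, hc⟩ := by
  have hl : ∀ c (hc : c + 1 < 2*n+2), c ≤ n → c + 1 ≠ k → σ ⟨c, by omega⟩ < σ ⟨c+1, hc⟩ := by
    intro c hc hcn hck
    by_contra hcon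
    have hlt : σ ⟨c+1, hc⟩ < σ ⟨c, by omega⟩ := by
      refine lt_of_le_of_ne (not_lt.1 hcon) fun h => ?_
      have := σ.injective h
      simp [Fin.ext_iff] at this
    have hd := Q7_desc n σ hσ ⟨c, by omega⟩ hlt
    have := hmin (sgen n ⟨c, by omega⟩)
      (Subgroup.subset_closure ⟨⟨c, by omega⟩, by simp only; omega, rfl⟩)
    have e1 := len7 n σ hσ
    have e2 := len7 n _ (mul_signed7 hσ (sgen_signed7 n ⟨c, by omega⟩))
    omega
  by_cases hcn : c ≤ n
  · exact hl c hc hcn h1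
  · exact asc_refl7 n σ hσ c hc (hl (2*n-c) (by omega) (by omega) (by omega))

theorem sum_castLE7 (k N : ℕ) (h : k ≤ N) (g : Fin N → ℤ) :
    ∑ j : Fin k, g (Fin.castLE h j) = ∑ a : Fin N, if (a : ℕ) < k then g a else 0 := by
  rw [← Finset.sum_filter]
  refine Finset.sum_bij (fun j _ => Fin.castLE h j) ?_ ?_ ?_ ?_
  · intro j _; simp
  · intro a _ b _ hab; simpa [Fin.ext_iff] using hab
  · intro b hb; exact ⟨⟨b, (Finset.mem_filter.1 hb).2⟩, Finset.mem_univ _, rfl⟩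
  · intros; rfl

theorem val_sum7 (N : ℕ) (a : Fin N) : ∑ b : Fin N, (if b < a then (1:ℤ) else 0) = (a : ℕ) := by
  rw [Finset.sum_boole]
  have : (Finset.univ.filter fun b : Fin N => b < a) = Finset.Iio a := by ext; simp
  rw [this, Fin.card_Iio]

theorem val_sum7' (N : ℕ) (w : Equiv.Perm (Fin N)) (a : Fin N) :
    ∑ b : Fin N, (if w b < w a then (1:ℤ) else 0) = (w a : ℕ) := by
  rw [← val_sum7 N (w a)]
  exact Equiv.sum_comp w (fun b => if b < w a then (1:ℤ) else 0)

/-- the local difference between the two sides -/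
def G7 (n k : ℕ) (w : Equiv.Perm (Fin (2*n+2))) (a b : Fin (2*n+2)) : ℤ :=
  (if a < b ∧ w b < w a then wt7 n a b else 0)
  - 2 * (if (a:ℕ) < k then (if w b < w a then 1 else 0) else 0)
  + 2 * (if (a:ℕ) < k then (if b < a then 1 else 0) else 0)
  + 2 * (if (a:ℕ) < k then (if bar n b < a ∧ w b < w a then 1 else 0) else 0)

theorem G7_symm (n k : ℕ) (hk : 1 ≤ k) (hkn : k ≤ n+1)
    (w : Equiv.Perm (Fin (2*n+2))) (hw : IsSigned n w)
    (h : ∀ c (hc : c + 1 < 2*n+2), c + 1 ≠ k → c + k ≠ 2*n+1 → w ⟨c, by omega⟩ < w ⟨c+1, hc⟩)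
    (a b : Fin (2*n+2)) : G7 n k w a b + G7 n k w (bar n b) (bar n a) = 0 := by
  have m1 : ∀ a b : Fin (2*n+2), (b:ℕ) < k → a < b → w a < w b := fun a b hb hab =>
    mono7' n w 0 (k-1) (fun c hc _ _ => h c hc (by omega) (by omega)) a b (by omega) (by omega) hab
  have m2 : ∀ a b : Fin (2*n+2), k ≤ (a:ℕ) → (b:ℕ) + k < 2*n+2 → a < b → w a < w b :=
    fun a b ha hb hab =>
    mono7' n w k (2*n+1-k) (fun c hc _ _ => h c hc (by omega) (by omega)) a b (by omega)
      (by omega) hab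
  have m3 : ∀ a b : Fin (2*n+2), 2*n+2 ≤ (a:ℕ) + k → a < b → w a < w b :=
    fun a b ha hab =>
    mono7' n w (2*n+2-k) (2*n+1) (fun c hc _ _ => h c hc (by omega) (by omega)) a b (by omega)
      (by omega) hab
  have p1 := m1 a b
  have p2 := m2 a b
  have p3 := m3 a b
  have q1 := m1 b a
  have q2 := m2 b a
  have q3 := m3 b a
  have ha := a.isLt
  have hb := b.isLt
  have la := (w a).isLt
  have lb := (w b).isLt
  have eq : (a:ℕ) = b → (w a : ℕ) = w b := fun h => by rw [Fin.ext h]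
  clear m1 m2 m3 h
  simp only [G7, wt7, hw a, hw b, bar_bar7, Fin.lt_def, bar_val7] at *
  generalize (w a : ℕ) = wa at *
  generalize (w b : ℕ) = wb at *
  obtain ⟨x, hx⟩ := a
  obtain ⟨y, hy⟩ := b
  clear hw
  simp only at *
  have f1 : 2*n+1 - y < 2*n+1 - x ↔ x < y := by omega
  have f2 : 2*n+1 - wa < 2*n+1 - wb ↔ wb < wa := by omega
  have f3 : 2*n+1 - y + (2*n+1 - x) = 2*n+1 ↔ x + y = 2*n+1 := by omega
  have f4 : 2*n+1 - x < 2*n+1 - y ↔ y < x := by omega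
  simp only [f1, f2, f3, f4]
  by_cases c1 : x < k <;> by_cases c2 : 2*n+1-y < k <;> by_cases c3 : wb < wa <;>
    by_cases c4 : x < y <;> simp only [c1, c2, c3, c4, if_true, if_false, and_true, and_false, true_and, false_and] <;> (try split_ifs) <;> omega

theorem G7_sum (n k : ℕ) (hk : 1 ≤ k) (hkn : k ≤ n+1)
    (w : Equiv.Perm (Fin (2*n+2))) (hw : IsSigned n w)
    (h : ∀ c (hc : c + 1 < 2*n+2), c + 1 ≠ k → c + k ≠ 2*n+1 → w ⟨c, by omega⟩ < w ⟨c+1, hc⟩) :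
    ∑ a, ∑ b, G7 n k w a b = 0 := by
  have e : ∑ a, ∑ b, G7 n k w a b = ∑ a, ∑ b, G7 n k w (bar n b) (bar n a) := by
    rw [Finset.sum_comm, ← Equiv.sum_comp (barE7 n)]
    refine Finset.sum_congr rfl fun a _ => ?_
    rw [← Equiv.sum_comp (barE7 n)]
    rfl
  have : ∑ a, ∑ b, G7 n k w a b + ∑ a, ∑ b, G7 n k w (bar n b) (bar n a) = 0 := by
    simp only [← Finset.sum_add_distrib, G7_symm n k hk hkn w hw h, Finset.sum_const_zero]
  omega

theorem D7 (n k : ℕ) (hk : k ≤ 2*n+2) (σ : Equiv.Perm (Fin (2*n+2))) (hσ : IsSigned n σ)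
    (j : Fin k) :
    ((Finset.univ.filter (fun i : Fin k => i < j ∧
      ((σ (Fin.castLE hk i) : ℕ) + 1) + ((σ (Fin.castLE hk j) : ℕ) + 1) > 2*n+3)).card : ℤ) =
    ∑ b, if bar n b < Fin.castLE hk j ∧ σ b < σ (Fin.castLE hk j) then 1 else 0 := by
  rw [← Finset.sum_boole]
  have := sum_castLE7 k (2*n+2) hk (fun i => if (i:ℕ) < j ∧
      ((σ i : ℕ) + 1) + ((σ (Fin.castLE hk j) : ℕ) + 1) > 2*n+3 then 1 else 0)
  refine Eq.trans this ?_
  rw [← Equiv.sum_comp (barE7 n)]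
  refine Finset.sum_congr rfl fun b _ => ?_
  change (if (bar n b : ℕ) < k then (if (bar n b:ℕ) < j ∧
      ((σ (bar n b) : ℕ) + 1) + ((σ (Fin.castLE hk j) : ℕ) + 1) > 2*n+3 then (1:ℤ) else 0) else 0) = _
  have hj := j.isLt
  have hl := (σ b).isLt
  rw [hσ]
  simp only [Fin.lt_def, bar_val7, Fin.val_castLE]
  split_ifs <;> omega

theorem stmt7 (n k : ℕ) (hk : 1 ≤ k) (hkn : k ≤ n+1)
    (σ : Equiv.Perm (Fin (2*n+2))) (hσ : IsSigned n σ) (hmin : IsMinRep n k σ) :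
    (len n σ : ℤ) =
      (k : ℤ) * ((2*n+2 : ℤ) - k) - (k : ℤ) * ((k : ℤ) - 1) / 2 -
        ∑ j : Fin k, partOfEven n k (by omega) σ j := by
  have hk' : k ≤ 2*n+2 := by omega
  have hG := G7_sum n k hk hkn σ hσ (fun c hc h1 h2 => asc7 n k hk σ hσ hmin c hc h1 h2)
  have hL := len7 n σ hσ
  have pull : ∀ (a : Fin (2*n+2)) (f : Fin (2*n+2) → ℤ),
      ∑ b, (if (a:ℕ) < k then f b else 0) = if (a:ℕ) < k then ∑ b, f b else 0 := by
    intro a f; split_ifs <;> simp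
  simp only [G7, Finset.sum_add_distrib, Finset.sum_sub_distrib, ← Finset.mul_sum, pull,
    val_sum7, val_sum7'] at hG
  rw [← sum_castLE7 k _ hk' (fun a => ((σ a : ℕ) : ℤ)), ← sum_castLE7 k _ hk' (fun a => ((a : ℕ) : ℤ)),
    ← sum_castLE7 k _ hk' (fun a => ∑ b, if bar n b < a ∧ σ b < σ a then (1:ℤ) else 0)] at hG
  change Q7 n σ - _ + _ + _ = 0 at hG
  simp only [partOfEven, D7 n k _ σ hσ, Finset.sum_add_distrib, Finset.sum_sub_distrib,
    Finset.sum_const, Finset.card_univ, Fintype.card_fin, nsmul_eq_mul, Fin.val_castLE] at hG ⊢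
  have hS : (∑ j : Fin k, ((j : ℕ) : ℤ)) * 2 = (k:ℤ) * (k - 1) := by
    rw [Fin.sum_univ_eq_sum_range (fun j => (j:ℤ)) k]
    have := Finset.sum_range_id_mul_two k
    zify [hk] at this
    exact this
  rw [← hS, Int.mul_ediv_cancel _ two_ne_zero]
  linarith
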